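/- For all nonnegative integers n and ℓ with n ≤ ℓ ≤ 2n, one has ∑_{k=0}^{⌊(ℓ-n)/2⌋} (-1)^k·C(n,k)·C(ℓ-2k, n) = ∑_{k=0}^{ℓ-n} C(n,k). -/

import Mathlib

open Finset Nat

theorem PowerSeries.coeff_one_add_X_pow_mul_mk_one {R : Type*} [CommRing R] (n m : ℕ) :
    PowerSeries.coeff m ((1 + PowerSeries.X) ^ n * PowerSeries.mk 1 : PowerSeries R) =
      ∑ k ∈ Finset.range (m + 1), (n.choose k : R) := by
  have h : ((1 + PowerSeries.X) ^ n : PowerSeries R) =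
      (((1 + Polynomial.X) ^ n : Polynomial R) : PowerSeries R) := by simp
  rw [PowerSeries.coeff_mul, h, Finset.Nat.sum_antidiagonal_eq_sum_range_succ_mk]
  simp only [Polynomial.coeff_coe, Polynomial.coeff_one_add_X_pow, PowerSeries.coeff_mk,
    Pi.one_apply, mul_one]

theorem PowerSeries.coeff_one_sub_X_sq_pow_mul {R : Type*} [CommRing R] (n m : ℕ)
    (hmn : m ≤ n) (f : PowerSeries R) :
    PowerSeries.coeff m ((1 - PowerSeries.X ^ 2) ^ n * f) =
      ∑ k ∈ Finset.range (m / 2 + 1),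
        (-1 : R) ^ k * (n.choose k : R) * PowerSeries.coeff (m - 2 * k) f := by
  have h : ((1 - PowerSeries.X ^ 2) ^ n : PowerSeries R) =
      ∑ k ∈ Finset.range (n + 1),
        PowerSeries.C ((-1 : R) ^ k * (n.choose k : R)) * PowerSeries.X ^ (2 * k) := by
    rw [sub_eq_neg_add, add_pow]
    refine Finset.sum_congr rfl fun k _ => ?_
    rw [neg_pow, one_pow, pow_mul]
    simp only [map_mul, map_pow, map_neg, map_one, map_natCast]
    ring
  rw [h, Finset.sum_mul, map_sum]
  simp only [mul_assoc, PowerSeries.coeff_C_mul, PowerSeries.coeff_X_pow_mul']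
  symm
  refine (Finset.sum_congr rfl fun k hk => ?_).trans
    (Finset.sum_subset (Finset.range_mono (by lia)) fun k _ hk => ?_)
  · rw [if_pos (by rw [Finset.mem_range] at hk; lia)]
  · rw [if_neg (by rw [Finset.mem_range] at hk; lia), mul_zero, mul_zero]

/-- For `n ≤ ℓ ≤ 2n`,
`∑_{k=0}^{⌊(ℓ-n)/2⌋} (-1)^k·C(n,k)·C(ℓ-2k, n) = ∑_{k=0}^{ℓ-n} C(n,k)`. -/
theorem tilted_path_one_point (n ℓ : ℕ) (h1 : n ≤ ℓ) (h2 : ℓ ≤ 2 * n) :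
    ∑ k ∈ Finset.range ((ℓ - n) / 2 + 1),
        (-1 : ℤ) ^ k * (n.choose k : ℤ) * ((ℓ - 2 * k).choose n : ℤ) =
      ∑ k ∈ Finset.range (ℓ - n + 1), (n.choose k : ℤ) := by
  have h : ((1 - PowerSeries.X ^ 2) ^ n * PowerSeries.mk 1 ^ (n + 1) : PowerSeries ℤ) =
      (1 + PowerSeries.X) ^ n * PowerSeries.mk 1 := by
    calc _ = ((1 + PowerSeries.X) ^ n * PowerSeries.mk 1 : PowerSeries ℤ) *
          (PowerSeries.mk 1 * (1 - PowerSeries.X)) ^ n := by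
            rw [show (1 - PowerSeries.X ^ 2 : PowerSeries ℤ) =
              (1 + PowerSeries.X) * (1 - PowerSeries.X) by ring, mul_pow, mul_pow]
            ring
      _ = _ := by rw [PowerSeries.mk_one_mul_one_sub_eq_one, one_pow, mul_one]
  rw [← PowerSeries.coeff_one_add_X_pow_mul_mk_one, ← h,
    PowerSeries.coeff_one_sub_X_sq_pow_mul n _ (by lia)]
  refine Finset.sum_congr rfl fun k hk => ?_
  rw [Finset.mem_range] at hk
  rw [PowerSeries.mk_one_pow_eq_mk_choose_add, PowerSeries.coeff_mk,
    show n + (ℓ - n - 2 * k) = ℓ - 2 * k by lia]
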